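/- arXiv:2507.10987 — 2 statements merged into one kernel-verified Lean document; each statement's English description precedes it below -/
import Mathlib

section
/- Let P be a monic q×q matrix polynomial of degree n ≥ 1 and let Q be a q×q matrix polynomial of degree at most n−1 such that f(z) := P(z²) + z·Q(z²) is a Hurwitz-type matrix (HTM) polynomial of degree 2n (with h-part P and g-part Q). Then every root of the scalar polynomial det P is a nonpositive real number; in particular all roots of det P lie in the closed left half-plane. -/
open Matrix MeasureTheory
open scoped ComplexOrder

noncomputable section

/-- The space of `q × q` complex matrices. -/
abbrev Mat (q : ℕ) := Matrix (Fin q) (Fin q) ℂ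

/-- The h-part of an even-degree matrix polynomial
`f(z) = A 0 * z^(2m) + ... + A (2m)`:  `h(z) = A 0 * z^m + A 2 * z^(m-1) + ... + A (2m)`. -/
def hEven (q m : ℕ) (A : ℕ → Mat q) (z : ℂ) : Mat q :=
  ∑ j ∈ Finset.range (m + 1), z ^ (m - j) • A (2 * j)

/-- The g-part of an even-degree matrix polynomial:
`g(z) = A 1 * z^(m-1) + A 3 * z^(m-2) + ... + A (2m-1)`. -/
def gEven (q m : ℕ) (A : ℕ → Mat q) (z : ℂ) : Mat q :=
  ∑ j ∈ Finset.range m, z ^ (m - 1 - j) • A (2 * j + 1)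

/-- The h-part of an odd-degree matrix polynomial
`f(z) = A 0 * z^(2m+1) + ... + A (2m+1)`:  `h(z) = A 1 * z^m + ... + A (2m+1)`. -/
def hOdd (q m : ℕ) (A : ℕ → Mat q) (z : ℂ) : Mat q :=
  ∑ j ∈ Finset.range (m + 1), z ^ (m - j) • A (2 * j + 1)

/-- The g-part of an odd-degree matrix polynomial: `g(z) = A 0 * z^m + ... + A (2m)`. -/
def gOdd (q m : ℕ) (A : ℕ → Mat q) (z : ℂ) : Mat q :=
  ∑ j ∈ Finset.range (m + 1), z ^ (m - j) • A (2 * j)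

/-- The matrix polynomial `f(z) = A 0 * z^n + A 1 * z^(n-1) + ... + A n`. -/
def fPoly (q n : ℕ) (A : ℕ → Mat q) (z : ℂ) : Mat q :=
  ∑ j ∈ Finset.range (n + 1), z ^ (n - j) • A j

/-- Continued fraction for the even case:  `wEven q m c d j z = w_{m-1-j}(z)`, where
`w_{m-1}(z) = z c_{m-1} + d_{m-1}⁻¹` and `w_k(z) = z c_k + (d_k + w_{k+1}(z)⁻¹)⁻¹`. -/
def wEven (q m : ℕ) (c d : ℕ → Mat q) : ℕ → ℂ → Mat q
  | 0, z => z • c (m - 1) + (d (m - 1))⁻¹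
  | j + 1, z => z • c (m - 2 - j) + (d (m - 2 - j) + (wEven q m c d j z)⁻¹)⁻¹

/-- Continued fraction for the odd case:  `wOdd q m c d j z = w_{m-1-j}(z)`, where
`w_{m-1}(z) = z c_{m-1} + (d_{m-1} + z⁻¹ c_m⁻¹)⁻¹`. -/
def wOdd (q m : ℕ) (c d : ℕ → Mat q) : ℕ → ℂ → Mat q
  | 0, z => z • c (m - 1) + (d (m - 1) + z⁻¹ • (c m)⁻¹)⁻¹
  | j + 1, z => z • c (m - 2 - j) + (d (m - 2 - j) + (wOdd q m c d j z)⁻¹)⁻¹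

/-- A Hurwitz-type matrix polynomial of degree 2m, described through its h-part and g-part:
there are Hermitian positive definite matrices `c_0, ..., c_{m-1}`, `d_0, ..., d_{m-1}` with
`g(z) h(z)⁻¹ = w_0(z)⁻¹` whenever `det (h z) ≠ 0` and all inverses in the recursion exist. -/
def IsHTMEven (q m : ℕ) (h g : ℂ → Mat q) : Prop :=
  ∃ c d : ℕ → Mat q,
    (∀ k < m, (c k).PosDef) ∧ (∀ k < m, (d k).PosDef) ∧
    ∀ z : ℂ, (h z).det ≠ 0 →
      (∀ j < m, IsUnit (wEven q m c d j z).det) →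
      (∀ j, j + 1 < m → IsUnit (d (m - 2 - j) + (wEven q m c d j z)⁻¹).det) →
      g z * (h z)⁻¹ = (wEven q m c d (m - 1) z)⁻¹

/-- A Hurwitz-type matrix polynomial of degree 2m+1, described through its h-part and g-part:
there are Hermitian positive definite matrices `c_0, ..., c_m`, `d_0, ..., d_{m-1}` with
`h(z) (z g(z))⁻¹ = w_0(z)⁻¹` whenever `z ≠ 0`, `det (g z) ≠ 0` and all inverses exist. -/
def IsHTMOdd (q m : ℕ) (h g : ℂ → Mat q) : Prop :=
  ∃ c d : ℕ → Mat q,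
    (∀ k ≤ m, (c k).PosDef) ∧ (∀ k < m, (d k).PosDef) ∧
    ∀ z : ℂ, z ≠ 0 → (g z).det ≠ 0 →
      IsUnit (d (m - 1) + z⁻¹ • (c m)⁻¹).det →
      (∀ j < m, IsUnit (wOdd q m c d j z).det) →
      (∀ j, j + 1 < m → IsUnit (d (m - 2 - j) + (wOdd q m c d j z)⁻¹).det) →
      h z * (z • g z)⁻¹ = (wOdd q m c d (m - 1) z)⁻¹

/-- `s_0, ..., s_{2m-1}` are Markov parameters of the even-degree polynomial with
coefficients `A`:  `z^(2m) g(z) - (∑_{j<2m} (-1)^j s_j z^(2m-1-j)) h(z)` has degree ≤ m-1. -/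
def MarkovEven (q m : ℕ) (A s : ℕ → Mat q) : Prop :=
  ∃ B : ℕ → Mat q, ∀ z : ℂ,
    z ^ (2 * m) • gEven q m A z
      - (∑ j ∈ Finset.range (2 * m), ((-1 : ℂ) ^ j * z ^ (2 * m - 1 - j)) • s j) * hEven q m A z
    = ∑ k ∈ Finset.range m, z ^ k • B k

/-- `s_0, ..., s_{2m}` are Markov parameters of the odd-degree polynomial with coefficients
`A`:  `z^(2m+1) h(z) - (∑_{j≤2m} (-1)^j s_j z^(2m-j)) z g(z)` has degree ≤ m. -/
def MarkovOdd (q m : ℕ) (A s : ℕ → Mat q) : Prop :=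
  ∃ B : ℕ → Mat q, ∀ z : ℂ,
    z ^ (2 * m + 1) • hOdd q m A z
      - (∑ j ∈ Finset.range (2 * m + 1), ((-1 : ℂ) ^ j * z ^ (2 * m - j)) • s j) *
          (z • gOdd q m A z)
    = ∑ k ∈ Finset.range (m + 1), z ^ k • B k

/-- The block Hankel matrix `H_{1,n-1} = (s_{i+j})_{i,j=0}^{n-1}` with `n` block rows. -/
def H1b (q : ℕ) (s : ℕ → Mat q) (n : ℕ) : Matrix (Fin n × Fin q) (Fin n × Fin q) ℂ :=
  Matrix.of fun p r => s ((p.1 : ℕ) + (r.1 : ℕ)) p.2 r.2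

/-- The block Hankel matrix `H_{2,n-1} = (s_{i+j+1})_{i,j=0}^{n-1}` with `n` block rows. -/
def H2b (q : ℕ) (s : ℕ → Mat q) (n : ℕ) : Matrix (Fin n × Fin q) (Fin n × Fin q) ℂ :=
  Matrix.of fun p r => s ((p.1 : ℕ) + (r.1 : ℕ) + 1) p.2 r.2

/-- The block column `Y_{1,n} = (s_n; s_{n+1}; ...; s_{2n-1})`. -/
def Y1b (q : ℕ) (s : ℕ → Mat q) (n : ℕ) : Matrix (Fin n × Fin q) (Fin q) ℂ :=
  Matrix.of fun p b => s (n + (p.1 : ℕ)) p.2 b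

/-- The block column `Y_{2,n} = (s_{n+1}; ...; s_{2n})`. -/
def Y2b (q : ℕ) (s : ℕ → Mat q) (n : ℕ) : Matrix (Fin n × Fin q) (Fin q) ℂ :=
  Matrix.of fun p b => s (n + 1 + (p.1 : ℕ)) p.2 b

/-- The block column `col (I, z I, ..., z^(n-1) I)`. -/
def colPow (q n : ℕ) (z : ℂ) : Matrix (Fin n × Fin q) (Fin q) ℂ :=
  Matrix.of fun p b => z ^ (p.1 : ℕ) * (if p.2 = b then 1 else 0)

/-- `r_i(z) = ∑_{k=1}^{i} z^(i-k) s_{k-1}`. -/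
def rPol (q : ℕ) (s : ℕ → Mat q) (i : ℕ) (z : ℂ) : Mat q :=
  ∑ k ∈ Finset.range i, z ^ (i - 1 - k) • s k

/-- `t_i(z) = ∑_{k=0}^{i} z^(i-k) s_k`. -/
def tPol (q : ℕ) (s : ℕ → Mat q) (i : ℕ) (z : ℂ) : Mat q :=
  ∑ k ∈ Finset.range (i + 1), z ^ (i - k) • s k

/-- The block column `col (r_0(z), ..., r_{n-1}(z))`. -/
def colR (q : ℕ) (s : ℕ → Mat q) (n : ℕ) (z : ℂ) : Matrix (Fin n × Fin q) (Fin q) ℂ :=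
  Matrix.of fun p b => rPol q s (p.1 : ℕ) z p.2 b

/-- The block column `col (t_0(z), ..., t_{n-1}(z))`. -/
def colT (q : ℕ) (s : ℕ → Mat q) (n : ℕ) (z : ℂ) : Matrix (Fin n × Fin q) (Fin q) ℂ :=
  Matrix.of fun p b => tPol q s (p.1 : ℕ) z p.2 b

/-- `P_{1,j}(z) = z^j I - Y_{1,j}^* H_{1,j-1}⁻¹ col(I, zI, ..., z^(j-1) I)`. -/
def P1 (q : ℕ) (s : ℕ → Mat q) (j : ℕ) (z : ℂ) : Mat q :=
  z ^ j • (1 : Mat q) - (Y1b q s j)ᴴ * (H1b q s j)⁻¹ * colPow q j z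

/-- `P_{2,j}(z) = z^j I - Y_{2,j}^* H_{2,j-1}⁻¹ col(I, zI, ..., z^(j-1) I)`. -/
def P2 (q : ℕ) (s : ℕ → Mat q) (j : ℕ) (z : ℂ) : Mat q :=
  z ^ j • (1 : Mat q) - (Y2b q s j)ᴴ * (H2b q s j)⁻¹ * colPow q j z

/-- `Q_{1,j}(z) = r_j(z) - Y_{1,j}^* H_{1,j-1}⁻¹ col(r_0(z), ..., r_{j-1}(z))`. -/
def Q1 (q : ℕ) (s : ℕ → Mat q) (j : ℕ) (z : ℂ) : Mat q :=
  rPol q s j z - (Y1b q s j)ᴴ * (H1b q s j)⁻¹ * colR q s j z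

/-- `Q_{2,j}(z) = t_j(z) - Y_{2,j}^* H_{2,j-1}⁻¹ col(t_0(z), ..., t_{j-1}(z))`. -/
def Q2 (q : ℕ) (s : ℕ → Mat q) (j : ℕ) (z : ℂ) : Mat q :=
  tPol q s j z - (Y2b q s j)ᴴ * (H2b q s j)⁻¹ * colT q s j z

/-- The block column `e = (I; 0; ...; 0)` with `n` blocks. -/
def eCol (q n : ℕ) : Matrix (Fin n × Fin q) (Fin q) ℂ :=
  Matrix.of fun p b => if (p.1 : ℕ) = 0 then (if p.2 = b then 1 else 0) else 0

/-- The block column `y = (s_0; s_1; ...; s_{n-1})`. -/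
def yCol (q : ℕ) (s : ℕ → Mat q) (n : ℕ) : Matrix (Fin n × Fin q) (Fin q) ℂ :=
  Matrix.of fun p b => s (p.1 : ℕ) p.2 b

/-- Condition C: `A_i^* A_k = A_k^* A_i` for every odd `i` and even `k` with `i, k ≤ n`. -/
def CondC (q n : ℕ) (A : ℕ → Mat q) : Prop :=
  ∀ i k, i ≤ n → k ≤ n → i % 2 = 1 → k % 2 = 0 → (A i)ᴴ * A k = (A k)ᴴ * A i

/-- The symmetrizer: for a polynomial with (descending) coefficients `Q_0, ..., Q_{n-1}`
(read off as `Q_j = A (2j)`), the `n × n` block Hankel matrix whose `(i,k)` block is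
`A (2(n-1-i-k))` if `i + k ≤ n - 1`, and `0` otherwise. -/
def Sh (q n : ℕ) (A : ℕ → Mat q) : Matrix (Fin n × Fin q) (Fin n × Fin q) ℂ :=
  Matrix.of fun p r =>
    if (p.1 : ℕ) + (r.1 : ℕ) ≤ n - 1 then A (2 * (n - 1 - (p.1 : ℕ) - (r.1 : ℕ))) p.2 r.2
    else 0

/-- The signature matrix `J̃ = diag (I, -I, I, ..., ±I)` with `n` blocks. -/
def Jt (q n : ℕ) : Matrix (Fin n × Fin q) (Fin n × Fin q) ℂ :=
  Matrix.diagonal (fun p => (-1 : ℂ) ^ (p.1 : ℕ))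

/-- The block row `(I, x² I, ..., x^(2n-2) I)`. -/
def Rev (q n : ℕ) (x : ℂ) : Matrix (Fin q) (Fin n × Fin q) ℂ :=
  Matrix.of fun a p => x ^ (2 * (p.1 : ℕ)) * (if a = p.2 then 1 else 0)

/-- The block column `(I; y² I; ...; y^(2n-2) I)`. -/
def Cev (q n : ℕ) (y : ℂ) : Matrix (Fin n × Fin q) (Fin q) ℂ :=
  Matrix.of fun p b => y ^ (2 * (p.1 : ℕ)) * (if p.2 = b then 1 else 0)

/-- The block row `(x I, x³ I, ..., x^(2n-1) I)`. -/
def Rod (q n : ℕ) (x : ℂ) : Matrix (Fin q) (Fin n × Fin q) ℂ :=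
  Matrix.of fun a p => x ^ (2 * (p.1 : ℕ) + 1) * (if a = p.2 then 1 else 0)

/-- The block column `(y I; y³ I; ...; y^(2n-1) I)`. -/
def Cod (q n : ℕ) (y : ℂ) : Matrix (Fin n × Fin q) (Fin q) ℂ :=
  Matrix.of fun p b => y ^ (2 * (p.1 : ℕ) + 1) * (if p.2 = b then 1 else 0)

section HurwitzMatrix

open Filter Topology

/-- The numerator-denominator pairs `(x_k, y_k)` of the matrix continued fraction with
parameters `C`, `D`: `y_{k+1} = D_k x_k + y_k` and `x_{k+1} = z C_k y_{k+1} + x_k`. -/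
def cfPair (q : ℕ) (C D : ℕ → Mat q) : ℕ → ℂ → Mat q × Mat q
  | 0, _ => (1, 0)
  | k + 1, z =>
    (z • (C k * (D k * (cfPair q C D k z).1 + (cfPair q C D k z).2)) + (cfPair q C D k z).1,
      D k * (cfPair q C D k z).1 + (cfPair q C D k z).2)

variable {q : ℕ} {C D : ℕ → Mat q}

lemma cfPair_succ_snd (k : ℕ) (z : ℂ) :
    (cfPair q C D (k + 1) z).2 = D k * (cfPair q C D k z).1 + (cfPair q C D k z).2 := rfl

lemma cfPair_succ_fst (k : ℕ) (z : ℂ) :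
    (cfPair q C D (k + 1) z).1 =
      z • (C k * (cfPair q C D (k + 1) z).2) + (cfPair q C D k z).1 := rfl

lemma Matrix.PosSemidef.exists_real_quadForm {M : Mat q} (hM : M.PosSemidef) (v : Fin q → ℂ) :
    ∃ a : ℝ, 0 ≤ a ∧ star v ⬝ᵥ M *ᵥ v = a := by
  have h := hM.dotProduct_mulVec_nonneg v
  rw [Complex.le_def] at h
  exact ⟨_, h.1, Complex.ext rfl h.2.symm⟩

lemma Matrix.PosDef.exists_real_quadForm {M : Mat q} (hM : M.PosDef) {v : Fin q → ℂ}
    (hv : v ≠ 0) : ∃ a : ℝ, 0 < a ∧ star v ⬝ᵥ M *ᵥ v = a := by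
  have h := hM.dotProduct_mulVec_pos hv
  rw [Complex.lt_def] at h
  exact ⟨_, h.1, Complex.ext rfl h.2.symm⟩

lemma star_mulVec_dotProduct_of_isHermitian {M : Mat q} (hM : M.IsHermitian) (u v : Fin q → ℂ) :
    star (M *ᵥ u) ⬝ᵥ v = star u ⬝ᵥ M *ᵥ v := by
  rw [star_mulVec, hM.eq, dotProduct_mulVec]

lemma cfPair_forms {n : ℕ} (hC : ∀ k < n, (C k).PosDef) (hD : ∀ k < n, (D k).PosDef)
    (z : ℂ) {v : Fin q → ℂ} (hv : v ≠ 0) {k : ℕ} (hk : k < n) :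
    (∃ a b : ℝ, 0 ≤ a ∧ 0 < b ∧
      star ((cfPair q C D (k + 1) z).2 *ᵥ v) ⬝ᵥ (cfPair q C D k z).1 *ᵥ v = z * a + b) ∧
    ∃ a b : ℝ, 0 ≤ a ∧ 0 < b ∧
      star ((cfPair q C D (k + 1) z).2 *ᵥ v) ⬝ᵥ (cfPair q C D (k + 1) z).1 *ᵥ v = z * a + b := by
  have step : ∀ k < n, (∃ a b : ℝ, 0 ≤ a ∧ 0 < b ∧
      star ((cfPair q C D (k + 1) z).2 *ᵥ v) ⬝ᵥ (cfPair q C D k z).1 *ᵥ v = z * a + b) →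
      ∃ a b : ℝ, 0 ≤ a ∧ 0 < b ∧
        star ((cfPair q C D (k + 1) z).2 *ᵥ v) ⬝ᵥ (cfPair q C D (k + 1) z).1 *ᵥ v
          = z * a + b := by
    rintro k hk ⟨a, b, ha, hb, h⟩
    obtain ⟨e, he, hee⟩ :=
      (hC k hk).posSemidef.exists_real_quadForm ((cfPair q C D (k + 1) z).2 *ᵥ v)
    refine ⟨e + a, b, by positivity, hb, ?_⟩
    rw [cfPair_succ_fst, add_mulVec, dotProduct_add, h, smul_mulVec, dotProduct_smul,
      ← mulVec_mulVec, hee]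
    push_cast
    rw [smul_eq_mul]
    ring
  suffices h : ∃ a b : ℝ, 0 ≤ a ∧ 0 < b ∧
      star ((cfPair q C D (k + 1) z).2 *ᵥ v) ⬝ᵥ (cfPair q C D k z).1 *ᵥ v = z * a + b from
    ⟨h, step k hk h⟩
  induction k with
  | zero =>
    obtain ⟨b, hb, h⟩ := (hD 0 hk).exists_real_quadForm hv
    refine ⟨0, b, le_rfl, hb, ?_⟩
    simp [cfPair, star_mulVec_dotProduct_of_isHermitian (hD 0 hk).1, h]
  | succ k ih =>
    obtain ⟨a, b, ha, hb, h⟩ := step k (by omega) (ih (by omega))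
    obtain ⟨e, he, hee⟩ :=
      (hD (k + 1) hk).posSemidef.exists_real_quadForm ((cfPair q C D (k + 1) z).1 *ᵥ v)
    refine ⟨a, e + b, ha, by positivity, ?_⟩
    rw [cfPair_succ_snd (k + 1), add_mulVec, star_add, add_dotProduct, h, ← mulVec_mulVec,
      star_mulVec_dotProduct_of_isHermitian (hD _ hk).1, hee]
    push_cast
    ring

lemma mul_ofReal_add_ofReal_ne_zero {z : ℂ} (hz : z ∈ Complex.slitPlane) {a b : ℝ}
    (ha : 0 ≤ a) (hb : 0 < b) : z * a + b ≠ 0 := by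
  intro h
  have h1 : z.re * a + b = 0 := by simpa using congrArg Complex.re h
  have h2 : z.im * a = 0 := by simpa using congrArg Complex.im h
  rcases hz with hz | hz
  · nlinarith [mul_nonneg hz.le ha]
  · rcases mul_eq_zero.1 h2 with h3 | h3
    · exact hz h3
    · simp [h3] at h1
      exact hb.ne' h1

lemma cfPair_snd_det_ne_zero {n : ℕ} (hC : ∀ k < n, (C k).PosDef) (hD : ∀ k < n, (D k).PosDef)
    {z : ℂ} (hz : z ∈ Complex.slitPlane) {k : ℕ} (hk : k < n) :
    (cfPair q C D (k + 1) z).2.det ≠ 0 := by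
  intro h
  obtain ⟨v, hv, hv0⟩ := exists_mulVec_eq_zero_iff.2 h
  obtain ⟨a, b, ha, hb, hab⟩ := (cfPair_forms hC hD z hv hk).1
  rw [hv0, star_zero, zero_dotProduct] at hab
  exact mul_ofReal_add_ofReal_ne_zero hz ha hb hab.symm

lemma cfPair_fst_det_ne_zero {n : ℕ} (hC : ∀ k < n, (C k).PosDef) (hD : ∀ k < n, (D k).PosDef)
    {z : ℂ} (hz : z ∈ Complex.slitPlane) {k : ℕ} (hk : k < n) :
    (cfPair q C D (k + 1) z).1.det ≠ 0 := by
  intro h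
  obtain ⟨v, hv, hv0⟩ := exists_mulVec_eq_zero_iff.2 h
  obtain ⟨a, b, ha, hb, hab⟩ := (cfPair_forms hC hD z hv hk).2
  rw [hv0, dotProduct_zero] at hab
  exact mul_ofReal_add_ofReal_ne_zero hz ha hb hab.symm

lemma wEven_eq_cfPair {n : ℕ} {c d : ℕ → Mat q} (hc : ∀ k < n, (c k).PosDef)
    (hd : ∀ k < n, (d k).PosDef) {z : ℂ} (hz : z ∈ Complex.slitPlane) {j : ℕ} (hj : j < n) :
    wEven q n c d j z =
      (cfPair q (fun k => c (n - 1 - k)) (fun k => d (n - 1 - k)) (j + 1) z).1 *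
        (cfPair q (fun k => c (n - 1 - k)) (fun k => d (n - 1 - k)) (j + 1) z).2⁻¹ := by
  have hC : ∀ k < n, (c (n - 1 - k)).PosDef := fun k hk => hc _ (by omega)
  have hD : ∀ k < n, (d (n - 1 - k)).PosDef := fun k hk => hd _ (by omega)
  have hy := (cfPair_snd_det_ne_zero hC hD hz hj).isUnit
  rw [cfPair_succ_fst, add_mul, smul_mul, mul_assoc, mul_nonsing_inv _ hy, mul_one]
  cases j with
  | zero => simp [cfPair, wEven]
  | succ j =>
    have hx := (cfPair_fst_det_ne_zero hC hD hz (k := j) (by omega)).isUnit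
    have hidx : n - 2 - j = n - 1 - (j + 1) := by omega
    rw [wEven, wEven_eq_cfPair hc hd hz (by omega : j < n), hidx, Matrix.mul_inv_rev,
      nonsing_inv_nonsing_inv _ (cfPair_snd_det_ne_zero hC hD hz (k := j) (by omega)).isUnit,
      cfPair_succ_snd (j + 1)]
    congr 1
    conv_rhs => rw [← nonsing_inv_nonsing_inv _ hx, ← Matrix.mul_inv_rev, add_mul, mul_assoc,
      nonsing_inv_nonsing_inv _ hx, mul_nonsing_inv _ hx, mul_one]

open scoped Matrix.Norms.Operator

lemma differentiable_cfPair (k : ℕ) :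
    Differentiable ℂ (fun z => (cfPair q C D k z).1) ∧
      Differentiable ℂ (fun z => (cfPair q C D k z).2) := by
  induction k with
  | zero => exact ⟨differentiable_const _, differentiable_const _⟩
  | succ k ih =>
    obtain ⟨h1, h2⟩ := ih
    simp only [cfPair]
    constructor <;> fun_prop

lemma exists_differentiable_bezout_cfPair (k : ℕ) :
    ∃ a b : ℂ → Mat q, Differentiable ℂ a ∧ Differentiable ℂ b ∧
      ∀ z, a z * (cfPair q C D k z).1 + b z * (cfPair q C D k z).2 = 1 := by
  induction k with
  | zero => exact ⟨fun _ => 1, fun _ => 0, by fun_prop, by fun_prop, by simp [cfPair]⟩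
  | succ k ih =>
    obtain ⟨a, b, ha, hb, h⟩ := ih
    refine ⟨fun z => a z - b z * D k,
      fun z => b z - z • ((a z - b z * D k) * C k), by fun_prop, by fun_prop, fun z => ?_⟩
    rw [← h z]
    simp only [cfPair, sub_mul, mul_add, smul_mul_assoc, mul_smul_comm, mul_assoc,
      smul_sub, smul_add]
    abel

lemma differentiable_matrix_det {f : ℂ → Mat q} (hf : Differentiable ℂ f) :
    Differentiable ℂ (fun z => (f z).det) := by
  have h : ∀ i j, Differentiable ℂ (fun z => f z i j) := fun i j =>
    (Matrix.entryLinearMap ℂ ℂ i j : Mat q →ₗ[ℂ] ℂ).toContinuousLinearMap.differentiable.comp hf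
  simp only [Matrix.det_apply]
  fun_prop

lemma differentiable_matrix_sum (s : Finset ℕ) (e : ℕ → ℕ) (A : ℕ → Mat q) :
    Differentiable ℂ (fun z : ℂ => ∑ j ∈ s, z ^ e j • A j) := by
  fun_prop

lemma tendsto_inv_cocompact_complex : Tendsto (fun z : ℂ => z⁻¹) (cocompact ℂ) (𝓝 0) := by
  rw [← Metric.cobounded_eq_cocompact]
  exact tendsto_inv₀_cobounded

lemma eventually_ne_cocompact_complex : ∀ᶠ z : ℂ in cocompact ℂ, z ≠ 0 :=
  (isCompact_singleton (x := (0 : ℂ))).compl_mem_cocompact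

lemma tendsto_cfPair {n : ℕ} (hC : ∀ k < n, (C k).PosDef) (hD : ∀ k < n, (D k).PosDef)
    {k : ℕ} (hk : k ≤ n) : ∃ L : Mat q, L.det ≠ 0 ∧
      Tendsto (fun z : ℂ => (z⁻¹) ^ k • (cfPair q C D k z).1) (cocompact ℂ) (𝓝 L) ∧
      Tendsto (fun z : ℂ => (z⁻¹) ^ k • (cfPair q C D k z).2) (cocompact ℂ) (𝓝 0) := by
  induction k with
  | zero => exact ⟨1, by simp, by simp [cfPair], by simp [cfPair]⟩
  | succ k ih =>
    obtain ⟨L, hL, hx, hy⟩ := ih (by omega)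
    have hy' : Tendsto (fun z : ℂ => (z⁻¹) ^ k • (cfPair q C D (k + 1) z).2) (cocompact ℂ)
        (𝓝 (D k * L)) := by
      have := (hx.const_mul (D k)).add hy
      rw [add_zero] at this
      refine this.congr fun z => ?_
      rw [cfPair_succ_snd, smul_add, mul_smul_comm]
    refine ⟨C k * (D k * L), ?_, ?_, ?_⟩
    · rw [det_mul, det_mul]
      exact mul_ne_zero (hC k hk).det_pos.ne' (mul_ne_zero (hD k hk).det_pos.ne' hL)
    · have := (hy'.const_mul (C k)).add (tendsto_inv_cocompact_complex.smul hx)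
      rw [zero_smul, add_zero] at this
      refine this.congr' ?_
      filter_upwards [eventually_ne_cocompact_complex] with z hz
      rw [cfPair_succ_fst, smul_add, smul_smul, smul_smul, pow_succ, mul_assoc,
        inv_mul_cancel₀ hz, mul_one, mul_smul_comm, mul_comm]
    · have := tendsto_inv_cocompact_complex.smul hy'
      rw [zero_smul] at this
      refine this.congr fun z => ?_
      rw [smul_smul, pow_succ']

lemma tendsto_matrix_polynomial (n : ℕ) (P : ℕ → Mat q) :
    Tendsto (fun z : ℂ => (z⁻¹) ^ n • ∑ j ∈ Finset.range (n + 1), z ^ (n - j) • P j)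
      (cocompact ℂ) (𝓝 (P 0)) := by
  have h : Tendsto (fun z : ℂ => ∑ j ∈ Finset.range (n + 1), (z⁻¹) ^ j • P j)
      (cocompact ℂ) (𝓝 (∑ j ∈ Finset.range (n + 1), (0 : ℂ) ^ j • P j)) :=
    tendsto_finsetSum _ fun j _ => (tendsto_inv_cocompact_complex.pow j).smul_const _
  have h0 : ∑ j ∈ Finset.range (n + 1), (0 : ℂ) ^ j • P j = P 0 := by
    simp [Finset.sum_range_succ']
  rw [h0] at h
  refine h.congr' ?_
  filter_upwards [eventually_ne_cocompact_complex] with z hz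
  rw [Finset.smul_sum]
  refine Finset.sum_congr rfl fun j hj => ?_
  have hjn : n = j + (n - j) := by have := Finset.mem_range.1 hj; omega
  rw [smul_smul]
  congr 1
  conv_rhs => rw [hjn, Nat.add_sub_cancel_left, pow_add]
  rw [mul_assoc, ← mul_pow, inv_mul_cancel₀ hz, one_pow, mul_one]

/-- If an entire matrix function `X U` has the same order of growth at infinity as `X`, both with
invertible leading coefficient, then `det U` has no zeros. -/
lemma det_ne_zero_of_tendsto {n : ℕ} {F X U : ℂ → Mat q} (hU : Differentiable ℂ U)
    (hF : ∀ z, F z = X z * U z) {L M : Mat q} (hL : L.det ≠ 0) (hM : M.det ≠ 0)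
    (hFM : Tendsto (fun z : ℂ => (z⁻¹) ^ n • F z) (cocompact ℂ) (𝓝 M))
    (hXL : Tendsto (fun z : ℂ => (z⁻¹) ^ n • X z) (cocompact ℂ) (𝓝 L)) (z : ℂ) :
    (U z).det ≠ 0 := by
  have hdet : Continuous (fun A : Mat q => A.det) := continuous_id.matrix_det
  have hX := (hdet.tendsto L).comp hXL
  have h : Tendsto (fun z => (U z).det) (cocompact ℂ) (𝓝 (M.det / L.det)) := by
    refine (((hdet.tendsto M).comp hFM).div hX hL).congr' ?_
    filter_upwards [hX.eventually_ne hL] with z hz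
    simp only [Function.comp_apply, Pi.div_apply] at hz ⊢
    rw [div_eq_iff hz, hF, ← smul_mul_assoc, det_mul, mul_comm]
  rw [(differentiable_matrix_det hU).apply_eq_of_tendsto_cocompact z h]
  exact div_ne_zero hM hL

/-- The h-part of a monic even-degree Hurwitz-type matrix polynomial is nonsingular off the
closed negative real axis. -/
lemma det_ne_zero_of_isHTMEven {n : ℕ} (hn : 1 ≤ n) {P Q : ℕ → Mat q} (hmonic : P 0 = 1)
    (hHTM : IsHTMEven q n
      (fun z => ∑ j ∈ Finset.range (n + 1), z ^ (n - j) • P j)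
      (fun z => ∑ j ∈ Finset.range n, z ^ (n - 1 - j) • Q j))
    {z : ℂ} (hslit : z ∈ Complex.slitPlane) :
    (∑ j ∈ Finset.range (n + 1), z ^ (n - j) • P j).det ≠ 0 := by
  intro hz
  obtain ⟨c, d, hc, hd, H⟩ := hHTM
  set C : ℕ → Mat q := fun k => c (n - 1 - k)
  set D : ℕ → Mat q := fun k => d (n - 1 - k)
  have hC : ∀ k < n, (C k).PosDef := fun k hk => hc _ (by omega)
  have hD : ∀ k < n, (D k).PosDef := fun k hk => hd _ (by omega)
  obtain ⟨a, b, ha, hb, hab⟩ := exists_differentiable_bezout_cfPair (C := C) (D := D) n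
  obtain ⟨L, hL, hXL, -⟩ := tendsto_cfPair hC hD le_rfl
  have hF := differentiable_matrix_sum (Finset.range (n + 1)) (fun j => n - j) P
  have hG := differentiable_matrix_sum (Finset.range n) (fun j => n - 1 - j) Q
  have hFP := tendsto_matrix_polynomial n P
  have hgood : ∀ z ∈ Complex.slitPlane,
      (∑ j ∈ Finset.range (n + 1), z ^ (n - j) • P j).det ≠ 0 →
      (∑ j ∈ Finset.range n, z ^ (n - 1 - j) • Q j) =
        (cfPair q C D n z).2 * (cfPair q C D n z).1⁻¹ *
          ∑ j ∈ Finset.range (n + 1), z ^ (n - j) • P j := by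
    intro z hz hP
    have hx := fun k (hk : k < n) => (cfPair_fst_det_ne_zero hC hD hz hk).isUnit
    have hy := fun k (hk : k < n) => (cfPair_snd_det_ne_zero hC hD hz hk).isUnit
    have hw := fun k (hk : k < n) => wEven_eq_cfPair hc hd hz hk
    have hwinv : ∀ k < n, (wEven q n c d k z)⁻¹ =
        (cfPair q C D (k + 1) z).2 * (cfPair q C D (k + 1) z).1⁻¹ := fun k hk => by
      rw [hw k hk, Matrix.mul_inv_rev, nonsing_inv_nonsing_inv _ (hy k hk)]
    have h := H z hP
      (fun k hk => by
        rw [hw k hk, det_mul]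
        exact (hx k hk).mul (isUnit_nonsing_inv_det _ (hy k hk)))
      (fun k hk => by
        have hidx : d (n - 2 - k) = D (k + 1) := congrArg d (by omega)
        have hsum : D (k + 1) + (cfPair q C D (k + 1) z).2 * (cfPair q C D (k + 1) z).1⁻¹ =
            (cfPair q C D (k + 1 + 1) z).2 * (cfPair q C D (k + 1) z).1⁻¹ := by
          rw [cfPair_succ_snd (k + 1), add_mul, mul_assoc,
            mul_nonsing_inv _ (hx k (by omega)), mul_one]
        rw [hwinv k (by omega), hidx, hsum, det_mul]
        exact (hy (k + 1) hk).mul (isUnit_nonsing_inv_det _ (hx k (by omega))))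
    rw [hwinv (n - 1) (by omega), Nat.sub_add_cancel hn] at h
    rw [← h, mul_assoc, nonsing_inv_mul _ hP.isUnit, mul_one]
  set F : ℂ → Mat q := fun z => ∑ j ∈ Finset.range (n + 1), z ^ (n - j) • P j
  set G : ℂ → Mat q := fun z => ∑ j ∈ Finset.range n, z ^ (n - 1 - j) • Q j
  have hU : Differentiable ℂ (fun z => a z * F z + b z * G z) := (ha.mul hF).add (hb.mul hG)
  have hFU : F = fun z => (cfPair q C D n z).1 * (a z * F z + b z * G z) := by
    have hdet : Continuous (fun A : Mat q => A.det) := continuous_id.matrix_det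
    have hne : ∀ᶠ z in cocompact ℂ, (F z).det ≠ 0 := by
      have h1 : (P 0).det ≠ 0 := by simp [hmonic]
      filter_upwards [((hdet.tendsto _).comp hFP).eventually_ne h1] with z hz h0
      refine hz ?_
      change ((z⁻¹) ^ n • F z).det = 0
      rw [det_smul, h0, mul_zero]
    have hreal : Tendsto (fun x : ℝ => (x : ℂ)) atTop (cocompact ℂ) :=
      Complex.isometry_ofReal.isClosedEmbedding.tendsto_cocompact.mono_left atTop_le_cocompact
    obtain ⟨r, hr, hr0⟩ := ((hreal.eventually hne).and (eventually_gt_atTop 0)).exists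
    have hrslit : (r : ℂ) ∈ Complex.slitPlane := Complex.ofReal_mem_slitPlane.2 hr0
    refine AnalyticOnNhd.eq_of_eventuallyEq (z₀ := (r : ℂ))
      (fun z _ => hF.analyticAt z)
      (fun z _ => ((differentiable_cfPair n).1.mul hU).analyticAt z) ?_
    filter_upwards [Complex.isOpen_slitPlane.mem_nhds hrslit,
      (hdet.comp hF.continuous).continuousAt.eventually_ne hr] with z hz hz0
    have hx : IsUnit (cfPair q C D n z).1.det := by
      have := cfPair_fst_det_ne_zero hC hD hz (Nat.sub_lt hn one_pos)
      rw [Nat.sub_add_cancel hn] at this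
      exact this.isUnit
    have hGz : G z = (cfPair q C D n z).2 * (cfPair q C D n z).1⁻¹ * F z := hgood z hz hz0
    have hUz : a z * F z + b z * G z = (cfPair q C D n z).1⁻¹ * F z := by
      rw [← one_mul ((cfPair q C D n z).1⁻¹ * F z), ← hab z, hGz, add_mul,
        mul_assoc (a z), mul_nonsing_inv_cancel_left _ _ hx]
      simp only [mul_assoc]
    rw [hUz, mul_nonsing_inv_cancel_left _ _ hx]
  have hUdet := det_ne_zero_of_tendsto hU (congrFun hFU) hL (by simp [hmonic]) hFP hXL z
  have hxz : (cfPair q C D n z).1.det = 0 := by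
    have h : (F z).det = 0 := hz
    rw [congrFun hFU z, det_mul] at h
    exact (mul_eq_zero.1 h).resolve_right hUdet
  have := cfPair_fst_det_ne_zero hC hD hslit (Nat.sub_lt hn one_pos)
  rw [Nat.sub_add_cancel hn] at this
  exact this hxz

end HurwitzMatrix

theorem stmt_18 (q n : ℕ) (hq : 1 ≤ q) (hn : 1 ≤ n) (P Q : ℕ → Mat q)
    (hmonic : P 0 = 1)
    (hHTM : IsHTMEven q n
      (fun z => ∑ j ∈ Finset.range (n + 1), z ^ (n - j) • P j)
      (fun z => ∑ j ∈ Finset.range n, z ^ (n - 1 - j) • Q j)) :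
    ∀ z : ℂ, (∑ j ∈ Finset.range (n + 1), z ^ (n - j) • P j).det = 0 →
      z.im = 0 ∧ z.re ≤ 0 := by
  intro z hz
  have hslit : z ∉ Complex.slitPlane := fun h => det_ne_zero_of_isHTMEven hn hmonic hHTM h hz
  rw [Complex.mem_slitPlane_iff, not_or, not_lt, not_not] at hslit
  exact hslit.symm

end
end

section
/- Let σ be a positive measure on ℝ whose support is contained in [0, ∞), is an infinite set, and which has finite moments of every order. Let m ≥ 2 and let p be a real polynomial of degree m with positive leading coefficient that is orthogonal to all lower-degree polynomials with respect to σ, i.e., ∫ t^k p(t) dσ(t) = 0 for k = 0, 1, ..., m−1. Then the polynomial f(z) := (−1)^m ( p(−z²) − z·p'(−z²) ) is a Hurwitz polynomial: every complex root of f has negative real part. -/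
open Matrix MeasureTheory
open scoped ComplexOrder

noncomputable section

open Polynomial in
theorem Polynomial.integrable_eval {σ : Measure ℝ}
    (hmom : ∀ k : ℕ, Integrable (fun t => t ^ k) σ) (p : ℝ[X]) :
    Integrable (fun t => p.eval t) σ := by
  simp only [eval_eq_sum_range]
  exact integrable_finsetSum _ fun k _ => (hmom k).const_mul _

open Polynomial in
theorem Polynomial.integral_mul_eq_zero_of_natDegree_lt {σ : Measure ℝ}
    (hmom : ∀ k : ℕ, Integrable (fun t => t ^ k) σ) {m : ℕ} {p : ℝ[X]}
    (horth : ∀ k < m, ∫ t, t ^ k * p.eval t ∂σ = 0) {r : ℝ[X]} (hr : r.natDegree < m) :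
    ∫ t, r.eval t * p.eval t ∂σ = 0 := by
  have hexp : ∀ t, r.eval t * p.eval t =
      ∑ k ∈ Finset.range (r.natDegree + 1), r.coeff k * (t ^ k * p.eval t) := fun t => by
    simp only [eval_eq_sum_range (p := r), Finset.sum_mul, mul_assoc]
  simp only [hexp]
  rw [integral_finsetSum]
  · refine Finset.sum_eq_zero fun k hk => ?_
    rw [integral_const_mul, horth k (by grind), mul_zero]
  · intro k _
    have h := ((X ^ k * p).integrable_eval hmom).const_mul (r.coeff k)
    simpa only [eval_mul, eval_pow, eval_X] using h

open Polynomial in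
/-- An orthogonal polynomial has no non-constant factor that is nonnegative on `[0, ∞)`. -/
theorem Polynomial.not_dvd_of_nonneg {σ : Measure ℝ}
    (hsupp : σ (Set.Iio 0) = 0)
    (hinf : ∀ S : Finset ℝ, σ ((↑S : Set ℝ)ᶜ) ≠ 0)
    (hmom : ∀ k : ℕ, Integrable (fun t => t ^ k) σ) {p : ℝ[X]} (hp : p ≠ 0)
    (horth : ∀ k < p.natDegree, ∫ t, t ^ k * p.eval t ∂σ = 0) {d : ℝ[X]}
    (hd : 0 < d.natDegree) (hnonneg : ∀ t, 0 ≤ t → 0 ≤ d.eval t) : ¬ d ∣ p := by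
  rintro ⟨r, rfl⟩
  have hr : r ≠ 0 := right_ne_zero_of_mul hp
  have hd0 : d ≠ 0 := left_ne_zero_of_mul hp
  have hint := integral_mul_eq_zero_of_natDegree_lt hmom horth (r := r)
    (by rw [natDegree_mul hd0 hr]; omega)
  simp only [← eval_mul] at hint
  have hpos : 0 ≤ᵐ[σ] fun t => (r * (d * r)).eval t := by
    have : ∀ᵐ t ∂σ, 0 ≤ t := by
      rw [ae_iff]; simpa [Set.Iio_def] using hsupp
    filter_upwards [this] with t ht
    have h := mul_nonneg (hnonneg t ht) (sq_nonneg (r.eval t))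
    simp only [eval_mul, Pi.zero_apply]
    linarith
  rw [integral_eq_zero_iff_of_nonneg_ae hpos (integrable_eval hmom _)] at hint
  refine hinf (r * (d * r)).roots.toFinset (measure_mono_null ?_ (ae_iff.mp hint))
  intro t ht hzero
  exact ht (by simpa [hr, hd0] using hzero)

/-- The real part of `z / (z ^ 2 + x)` is nonnegative on the closed right half-plane. -/
theorem Complex.re_div_sq_add_nonneg {z : ℂ} (hz : 0 ≤ z.re) {x : ℝ} (hx : 0 ≤ x) :
    0 ≤ (z / (z ^ 2 + x)).re := by
  rw [Complex.div_re, ← add_div]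
  refine div_nonneg ?_ (Complex.normSq_nonneg _)
  have : z.re * (z ^ 2 + x).re + z.im * (z ^ 2 + x).im
      = z.re * (z.re ^ 2 + z.im ^ 2 + x) := by
    simp [pow_two]; ring
  rw [this]
  positivity

open Polynomial in
theorem Polynomial.re_neg_of_eval_eq_mul_eval_derivative {P : ℂ[X]}
    (hroots : ∀ c ∈ P.roots, ∃ x : ℝ, 0 < x ∧ c = x ∧ P.derivative.eval c ≠ 0) (hP : P ≠ 0)
    {z : ℂ} (h : P.eval (-z ^ 2) = z * P.derivative.eval (-z ^ 2)) : z.re < 0 := by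
  by_contra! hz
  by_cases hw : P.eval (-z ^ 2) = 0
  · obtain ⟨x, hx, hzx, hd⟩ := hroots _ ((mem_roots hP).2 hw)
    rcases mul_eq_zero.1 (h.symm.trans hw) with rfl | h0
    · simp at hzx
      exact hx.ne (by exact_mod_cast hzx)
    · exact hd h0
  · have key := (IsAlgClosed.splits P).eval_derivative_div_eval_of_ne_zero hw
    have h1 : z * (P.derivative.eval (-z ^ 2) / P.eval (-z ^ 2)) = 1 := by
      rw [← mul_div_assoc, ← h, div_self hw]
    rw [key, ← Multiset.sum_map_mul_left] at h1
    have hneg : 0 ≤ (-(P.roots.map fun c => z * (1 / (-z ^ 2 - c))).sum).re := by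
      rw [← Multiset.sum_map_neg', ← Complex.coe_reAddGroupHom, map_multiset_sum]
      simp only [Multiset.map_map]
      refine Multiset.sum_nonneg fun y hy => ?_
      obtain ⟨c, hc, rfl⟩ := Multiset.mem_map.1 hy
      obtain ⟨x, hx, rfl, -⟩ := hroots c hc
      have : -(z * (1 / (-z ^ 2 - (x : ℂ)))) = z / (z ^ 2 + x) := by
        rw [show -z ^ 2 - (x : ℂ) = -(z ^ 2 + x) by ring, div_neg]
        ring
      simpa only [Function.comp_apply, Complex.coe_reAddGroupHom, this] using
        Complex.re_div_sq_add_nonneg hz hx.le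
    rw [h1] at hneg
    norm_num at hneg

theorem stmt_19 (σ : Measure ℝ)
    (hsupp : σ (Set.Iio 0) = 0)
    (hinf : ∀ S : Finset ℝ, σ ((↑S : Set ℝ)ᶜ) ≠ 0)
    (hmom : ∀ k : ℕ, Integrable (fun t => t ^ k) σ)
    (m : ℕ) (hm : 2 ≤ m) (p : Polynomial ℝ)
    (hdeg : p.natDegree = m) (hlead : 0 < p.leadingCoeff)
    (horth : ∀ k < m, ∫ t, t ^ k * p.eval t ∂σ = 0) :
    ∀ z : ℂ,
      (-1 : ℂ) ^ m *
          (Polynomial.aeval (-z ^ 2) p - z * Polynomial.aeval (-z ^ 2) p.derivative) = 0 →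
      z.re < 0 := by
  open Polynomial in
  intro z hz
  subst hdeg
  have hp : p ≠ 0 := by rintro rfl; simp at hm
  have hmap : p.map (algebraMap ℝ ℂ) ≠ 0 := Polynomial.map_ne_zero hp
  have hndvd : ∀ d : ℝ[X], 0 < d.natDegree → (∀ t, 0 ≤ t → 0 ≤ d.eval t) → ¬ d ∣ p :=
    fun d => Polynomial.not_dvd_of_nonneg hsupp hinf hmom hp horth
  refine Polynomial.re_neg_of_eval_eq_mul_eval_derivative (P := p.map (algebraMap ℝ ℂ))
    (fun c hc => ?_) hmap ?_
  · have hc0 : aeval c p = 0 := by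
      simpa [eval_map_algebraMap] using (mem_roots hmap).1 hc
    have him : c.im = 0 := by
      by_contra him
      have hdvd := p.quadratic_dvd_of_aeval_eq_zero_im_ne_zero hc0 him
      have hd : (X ^ 2 - C (2 * c.re) * X + C (‖c‖ ^ 2) : ℝ[X]).natDegree = 2 := by
        compute_degree!
      refine hndvd _ (by rw [hd]; norm_num) (fun t _ => ?_) hdvd
      have hn : ‖c‖ ^ 2 = c.re ^ 2 + c.im ^ 2 := by
        rw [Complex.sq_norm, Complex.normSq_apply]; ring
      simp only [eval_add, eval_sub, eval_mul, eval_pow, eval_X, eval_C, hn]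
      nlinarith [sq_nonneg (t - c.re), sq_nonneg c.im]
    obtain ⟨x, rfl⟩ : ∃ x : ℝ, c = x := ⟨c.re, by apply Complex.ext <;> simp [him]⟩
    have hof : ∀ q : ℝ[X], (q.map (algebraMap ℝ ℂ)).eval (x : ℂ) = (q.eval x : ℝ) := fun q =>
      eval_map_apply (algebraMap ℝ ℂ) x
    have hx0 : p.IsRoot x := by
      have := (mem_roots hmap).1 hc
      rw [IsRoot, hof] at this
      exact_mod_cast this
    refine ⟨x, ?_, rfl, fun hder => ?_⟩
    · by_contra! hx
      exact hndvd (X - C x) (by simp) (fun t ht => by simp; linarith) (dvd_iff_isRoot.2 hx0)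
    · rw [derivative_map, hof] at hder
      have hder' : p.derivative.IsRoot x := by exact_mod_cast hder
      have hmult := (one_lt_rootMultiplicity_iff_isRoot hp).2 ⟨hx0, hder'⟩
      exact hndvd ((X - C x) ^ 2) (by simp) (fun t _ => by simp; positivity)
        ((le_rootMultiplicity_iff hp).1 hmult)
  · have := (mul_eq_zero.1 hz).resolve_left (pow_ne_zero _ (by norm_num))
    rw [derivative_map, eval_map_algebraMap, eval_map_algebraMap]
    exact sub_eq_zero.1 this

end
end
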